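/- The retraction r : I_n → A_n is a quasi-isomorphism: the map induced by r on cohomology, H(I_n) → H(A_n), is an isomorphism of graded k_n-algebras; equivalently, the inclusion A_n ↪ I_n induces an isomorphism on cohomology. -/

import Mathlib

/-!
Internal DG-algebra of Ekholm–Ng. Fix a field `K`, `n ≥ 1` and integers `m : Fin n → ℤ`.
`IAlg K n` is the free associative `k_n`-algebra on generators `c^p_{ij}` (with
`c^0_{ij} = 0` for `i ≥ j`), realised as a quotient of the free `K`-algebra on the
generators together with the orthogonal idempotents `e i` spanning `k_n`.
-/

namespace InternalAlgebra

inductive IGen (n : ℕ) : Type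
  | e (i : Fin n) : IGen n
  | c (p : ℕ) (i j : Fin n) : IGen n

open IGen

variable (K : Type) [Field K] (n : ℕ)

/-- Relations defining the free `k_n`-algebra on the generators `c^p_{ij}`:
the `e i` are orthogonal idempotents summing to `1`, each `c^p_{ij}` satisfies
`e j * c^p_{ij} = c^p_{ij} = c^p_{ij} * e i`, and `c^0_{ij} = 0` unless `i < j`. -/
inductive Rel : FreeAlgebra K (IGen n) → FreeAlgebra K (IGen n) → Prop
  | idem (i : Fin n) :
      Rel (FreeAlgebra.ι K (e i) * FreeAlgebra.ι K (e i)) (FreeAlgebra.ι K (e i))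
  | orth (i j : Fin n) (h : i ≠ j) :
      Rel (FreeAlgebra.ι K (e i) * FreeAlgebra.ι K (e j)) 0
  | total : Rel (∑ i : Fin n, FreeAlgebra.ι K (e i)) 1
  | left (p : ℕ) (i j : Fin n) :
      Rel (FreeAlgebra.ι K (e j) * FreeAlgebra.ι K (c p i j)) (FreeAlgebra.ι K (c p i j))
  | right (p : ℕ) (i j : Fin n) :
      Rel (FreeAlgebra.ι K (c p i j) * FreeAlgebra.ι K (e i)) (FreeAlgebra.ι K (c p i j))
  | czero (i j : Fin n) (h : ¬ i < j) : Rel (FreeAlgebra.ι K (c 0 i j)) 0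

/-- The internal algebra `I_n` (as a `K`-algebra; the `k_n`-structure is spanned by
the images of the idempotents `e i`). -/
abbrev IAlg := RingQuot (Rel K n)

/-- The image of a generator in `I_n`. -/
def ι (g : IGen n) : IAlg K n := RingQuot.mkAlgHom K (Rel K n) (FreeAlgebra.ι K g)

variable (m : Fin n → ℤ)

/-- Degrees of the generators: `|e i| = 0`, `|c^p_{ij}| = 1 - 2p + m j - m i`. -/
def dg : IGen n → ℤ
  | e _ => 0
  | c p i j => 1 - 2 * (p : ℤ) + m j - m i

/-- The homogeneous component of degree `d`: the `K`-span of products of generators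
whose degrees sum to `d`. -/
def Hgr (d : ℤ) : Submodule K (IAlg K n) :=
  Submodule.span K
    { x | ∃ l : List (IGen n), (l.map (dg n m)).sum = d ∧ x = (l.map (ι K n)).prod }

/-- `(-1)^d` as an element of `K`. -/
def sgn (d : ℤ) : K := if Even d then 1 else -1

/-- The prescribed values of the differential on the generators. -/
def Dval : IGen n → IAlg K n
  | e _ => 0
  | c 0 i j =>
      ∑ r : Fin n,
        if i < r ∧ r < j then
          sgn K (m r + m j) • (ι K n (c 0 r j) * ι K n (c 0 i r)) else 0
  | c 1 i j =>
      (if i = j then ι K n (e i) else 0)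
      + ∑ r : Fin n,
          ((if i < r then sgn K (m r + m j) • (ι K n (c 1 r j) * ι K n (c 0 i r)) else 0)
            + (if r < j then sgn K (m r + m j) • (ι K n (c 0 r j) * ι K n (c 1 i r)) else 0))
  | c (p + 2) i j =>
      ∑ q ∈ Finset.range (p + 3), ∑ r : Fin n,
        sgn K (m r + m j) • (ι K n (c (p + 2 - q) r j) * ι K n (c q i r))

/-- The subalgebra `A_n` generated over `k_n` by the `c^0_{ij}` and `c^1_{ij}`. -/
def Asub : Subalgebra K (IAlg K n) :=
  Algebra.adjoin K
    ({x | ∃ i, x = ι K n (e i)} ∪ {x | ∃ i j, x = ι K n (c 0 i j)}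
      ∪ {x | ∃ i j, x = ι K n (c 1 i j)})

/-- `D` vanishes on `k_n`, takes the prescribed values on the generators, and satisfies
the graded Leibniz rule. -/
def IsDiff (D : IAlg K n →ₗ[K] IAlg K n) : Prop :=
  (∀ i : Fin n, D (ι K n (e i)) = 0) ∧
  (∀ (p : ℕ) (i j : Fin n), D (ι K n (c p i j)) = Dval K n m (c p i j)) ∧
  (∀ (d : ℤ) (a b : IAlg K n), a ∈ Hgr K n m d →
    D (a * b) = D a * b + sgn K d • (a * D b))

/-- The composable chain `c^q_{k_L j} ⋯ c^1_{k_1 k_2} c^1_{i k_1}` (leftmost factor has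
superscript `q`, all others superscript `1`; multiplications are read right-to-left). -/
def chainQ (q : ℕ) : Fin n → List (Fin n) → Fin n → IAlg K n
  | i, [], j => ι K n (c q i j)
  | i, k :: ks, j => chainQ q k ks j * ι K n (c 1 i k)

/-- The value of the retraction on `c^p_{ij}` for `p > 1`:
`r(c^p_{ij}) = C_{p−1} Σ_{k_1,…,k_{2p−2}} (−1)^{m_{k_1}+⋯+m_{k_{2p−2}}}
c^1_{k_{2p−2} j} ⋯ c^1_{k_1 k_2} c^1_{i k_1}`. -/
def Rval (p : ℕ) (i j : Fin n) : IAlg K n :=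
  (catalan (p - 1) : K) •
    ∑ ks : Fin (2 * (p - 1)) → Fin n,
      sgn K (∑ t, m (ks t)) • chainQ K n 1 i (List.ofFn ks) j

/-- `r` is the `k_n`-algebra endomorphism of `I_n` fixing `e i`, `c^0_{ij}`, `c^1_{ij}`
and taking the prescribed values on `c^p_{ij}` for `p > 1`. -/
def IsRetr (r : IAlg K n →ₐ[K] IAlg K n) : Prop :=
  (∀ i : Fin n, r (ι K n (e i)) = ι K n (e i)) ∧
  (∀ i j : Fin n, r (ι K n (c 0 i j)) = ι K n (c 0 i j)) ∧
  (∀ i j : Fin n, r (ι K n (c 1 i j)) = ι K n (c 1 i j)) ∧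
  (∀ (p : ℕ) (i j : Fin n), 1 < p → r (ι K n (c p i j)) = Rval K n m p i j)

end InternalAlgebra

open InternalAlgebra


/-- The coefficients of the power series solution `g` of
`g = 1 + b₁ ((b - b₀) g - g (F - F₀))`. -/
def gaugeCoeff {R : Type*} [Ring R] (b F : ℕ → R) : ℕ → R
  | 0 => 1
  | p + 1 => b 1 * ∑ q : Fin (p + 1),
      (b (p - q + 1) * gaugeCoeff b F q - gaugeCoeff b F q * F (p - q + 1))
decreasing_by all_goals exact q.2

section Gauge

open PowerSeries Finset

variable {R : Type*} [Ring R]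

theorem map_gaugeCoeff (θ : R →+* R) {b F : ℕ → R} (hb : ∀ p, θ (b p) = -b p)
    (hF : ∀ p, θ (F p) = -F p) (p : ℕ) : θ (gaugeCoeff b F p) = gaugeCoeff b F p := by
  induction p using Nat.strong_induction_on with
  | _ p ih =>
    cases p with
    | zero => simp [gaugeCoeff]
    | succ p =>
      rw [gaugeCoeff, map_mul, map_sum, hb, neg_mul, ← mul_neg, ← sum_neg_distrib]
      congr 1
      refine sum_congr rfl fun q _ => ?_
      rw [map_sub, map_mul, map_mul, hb, hF, ih q q.2]
      noncomm_ring

theorem mk_eq_C_add_X_mul (f : ℕ → R) :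
    PowerSeries.mk f = C (f 0) + X * PowerSeries.mk fun p => f (p + 1) := by
  ext p
  cases p with
  | zero => simp
  | succ p => simp [coeff_succ_X_mul]

theorem mk_gaugeCoeff (b F : ℕ → R) :
    PowerSeries.mk (gaugeCoeff b F) = 1 + C (b 1) * (X *
      ((PowerSeries.mk fun p => b (p + 1)) * PowerSeries.mk (gaugeCoeff b F) -
        PowerSeries.mk (gaugeCoeff b F) * PowerSeries.mk fun p => F (p + 1))) := by
  ext p
  cases p with
  | zero => simp [gaugeCoeff]
  | succ p =>
    rw [map_add, coeff_C_mul, coeff_succ_X_mul, coeff_mk, gaugeCoeff, coeff_one,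
      if_neg p.succ_ne_zero, zero_add, map_sub, coeff_mul, coeff_mul, sum_sub_distrib,
      ← Finset.Nat.sum_antidiagonal_swap,
      Finset.Nat.sum_antidiagonal_eq_sum_range_succ_mk,
      Finset.Nat.sum_antidiagonal_eq_sum_range_succ_mk, sum_range, sum_range]
    simp

theorem eq_zero_of_eq_mul_X_mul {E U V W : R⟦X⟧} (h : E = U * (X * (V * E + E * W))) : E = 0 := by
  have key : ∀ p, ∀ q ≤ p, coeff q E = 0 := by
    have step : ∀ p, (∀ q < p, coeff q E = 0) → coeff p E = 0 := by
      intro p hp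
      rw [h, coeff_mul]
      refine sum_eq_zero fun x hx => ?_
      have hx' := mem_antidiagonal.1 hx
      rcases hk : x.2 with _ | k
      · simp
      · rw [coeff_succ_X_mul, map_add, coeff_mul, coeff_mul, sum_eq_zero, sum_eq_zero]
        · simp
        · intro y hy
          have := mem_antidiagonal.1 hy
          rw [hp y.1 (by omega), zero_mul]
        · intro y hy
          have := mem_antidiagonal.1 hy
          rw [hp y.2 (by omega), mul_zero]
    intro p
    induction p with
    | zero => intro q hq; exact step q (by omega)
    | succ p ih => intro q hq; exact step q fun r hr => ih r (by omega)
  ext p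
  simpa using key p p le_rfl

/-- The gauge equation `δ g = b g - g F` for the solution of
`g = 1 + b₁ ((b - b₀) g - g (F - F₀))`, where `b` and `F` are odd solutions of
`δ b = b² + t`. -/
theorem map_gaugeCoeff_eq (θ : R →+* R) (δ : R →+ R)
    (hδ : ∀ x y, δ (x * y) = δ x * y + θ x * δ y) {b F : ℕ → R}
    (hb : ∀ p, θ (b p) = -b p) (hF : ∀ p, θ (F p) = -F p)
    (h0 : F 0 = b 0)
    (hδb : ∀ p, δ (b p) = ∑ x ∈ antidiagonal p, b x.1 * b x.2 + if p = 1 then 1 else 0)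
    (hδF : ∀ p, δ (F p) = ∑ x ∈ antidiagonal p, F x.1 * F x.2 + if p = 1 then 1 else 0)
    (p : ℕ) :
    δ (gaugeCoeff b F p) =
      ∑ x ∈ antidiagonal p,
        (b x.1 * gaugeCoeff b F x.2 - gaugeCoeff b F x.1 * F x.2) := by
  let Δ : R⟦X⟧ →+ R⟦X⟧ :=
    { toFun := fun f => PowerSeries.mk fun p => δ (coeff p f)
      map_zero' := by ext; simp
      map_add' := fun f g => by ext; simp }
  have coeffΔ (f : R⟦X⟧) (p : ℕ) : coeff p (Δ f) = δ (coeff p f) :=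
    coeff_mk p fun p => δ (coeff p f)
  have hΔ (f g : R⟦X⟧) : Δ (f * g) = Δ f * g + PowerSeries.map θ f * Δ g := by
    ext p
    rw [coeffΔ, map_add, coeff_mul, coeff_mul, coeff_mul, map_sum, ← sum_add_distrib]
    exact sum_congr rfl fun x _ => by rw [hδ, coeffΔ, coeffΔ, coeff_map]
  have hmap {f : ℕ → R} (hf : ∀ p, θ (f p) = -f p) :
      PowerSeries.map θ (PowerSeries.mk f) = -PowerSeries.mk f := by
    ext p; simp [hf]
  have hsq {f : ℕ → R}
      (hf : ∀ p, δ (f p) = ∑ x ∈ antidiagonal p, f x.1 * f x.2 + if p = 1 then 1 else 0) :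
      Δ (PowerSeries.mk f) = PowerSeries.mk f * PowerSeries.mk f + X := by
    ext p
    rw [coeffΔ, coeff_mk, hf, map_add, coeff_mul, coeff_X]
    simp
  have hδ1 : δ 1 = 0 := by simpa using hδ 1 1
  have hΔC (a : R) : Δ (C a) = C (δ a) := by
    ext p
    rw [coeffΔ, coeff_C, coeff_C]
    split_ifs <;> simp
  have hΔ1 : Δ 1 = 0 := by rw [← map_one C, hΔC, hδ1, map_zero]
  have hbC : PowerSeries.map θ (C (b 1)) = -C (b 1) := by rw [map_C, hb, map_neg]
  have hbC0 : PowerSeries.map θ (C (b 0)) = -C (b 0) := by rw [map_C, hb, map_neg]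
  have hΔ0 : Δ (C (b 0)) = C (b 0) * C (b 0) := by
    rw [hΔC, hδb]; simp
  have hΔb1 : Δ (C (b 1)) = C (b 0) * C (b 1) + C (b 1) * C (b 0) + 1 := by
    rw [hΔC, hδb]; simp [Finset.Nat.antidiagonal_succ]
  have hG := mk_gaugeCoeff b F
  have hGθ : PowerSeries.map θ (PowerSeries.mk (gaugeCoeff b F)) =
      PowerSeries.mk (gaugeCoeff b F) := by
    ext p; simp [map_gaugeCoeff θ hb hF]
  have hB := mk_eq_C_add_X_mul b
  have hFX := mk_eq_C_add_X_mul F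
  have hbθ := hmap hb
  have hFθ := hmap hF
  have hΔb := hsq hδb
  have hΔF := hsq hδF
  rw [h0] at hFX
  set G := PowerSeries.mk (gaugeCoeff b F)
  set B := PowerSeries.mk b
  set Φ := PowerSeries.mk F
  set B' := PowerSeries.mk fun p => b (p + 1)
  set Φ' := PowerSeries.mk fun p => F (p + 1)
  have hBX : X * B' = B - C (b 0) := by rw [hB]; abel
  have hΦX : X * Φ' = Φ - C (b 0) := by rw [hFX]; abel
  have hX (f g : R⟦X⟧) : X * (f * g) = f * (X * g) := by
    rw [← mul_assoc, ← mul_assoc, (commute_X f).eq]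
  have hXG : X * (B' * G - G * Φ') = (B - C (b 0)) * G - G * (Φ - C (b 0)) := by
    rw [mul_sub, hX G, hΦX, ← mul_assoc, hBX]
  have hGX : X * G = G * X := (commute_X G).eq.symm
  rw [hXG] at hG
  set β := C (b 0)
  set c := C (b 1)
  set E := Δ G - B * G + G * Φ with hE
  have hΔG : Δ G = E + B * G - G * Φ := by rw [hE]; abel
  obtain ⟨W, hW⟩ : ∃ W, W = (B - β) * G - G * (Φ - β) := ⟨_, rfl⟩
  have hΔW : Δ W = β * W + W * β - ((B - β) * E + E * (Φ - β)) := by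
    have h : Δ W = (B * B + X - β * β) * G - (B - β) * Δ G
        - Δ G * (Φ - β) - G * (Φ * Φ + X - β * β) := by
      rw [hW, map_sub, hΔ, hΔ, hGθ, map_sub, map_sub, map_sub, hbθ, hbC0, hΔb, hΔF, hΔ0]
      noncomm_ring
    have hcomm : (B * B + X - β * β) * G - G * (Φ * Φ + X - β * β) =
        (B * B - β * β) * G - G * (Φ * Φ - β * β) := by
      simp only [add_mul, sub_mul, mul_add, mul_sub, hGX]
      abel
    rw [← sub_eq_zero] at hcomm
    rw [h, hΔG, hW, ← sub_eq_zero, ← hcomm]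
    noncomm_ring
  rw [← hW] at hG
  have hEeq : E = c * (X * (B' * E + E * Φ')) := by
    have h1 : X * (B' * E + E * Φ') = (B - β) * E + E * (Φ - β) := by
      rw [mul_add, hX E, hΦX, ← mul_assoc, hBX]
    have h2 : Δ G = (β * c + c * β + 1) * W - c * Δ W := by
      conv_lhs => rw [hG]
      rw [map_add, hΔ1, hΔ, hbC, hΔb1]
      noncomm_ring
    have h3 : E = Δ G - W - β * G + G * β := by
      rw [hE, hW]
      noncomm_ring
    rw [h1]
    conv_lhs => rw [h3, h2, hΔW, hG]
    noncomm_ring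
  have hE0 : E = 0 := eq_zero_of_eq_mul_X_mul hEeq
  have := congrArg (coeff p) hΔG
  rw [hE0, coeffΔ, zero_add, map_sub, coeff_mul, coeff_mul, ← sum_sub_distrib] at this
  simpa [G, B, Φ] using this

end Gauge

namespace InternalAlgebra

open IGen Finset

/-- A shortcut instance making negation and subtraction of `IAlg` unify with those of `Ring`. -/
local instance instRingIAlg (K : Type) [Field K] (n : ℕ) :
    Ring (IAlg K n) := inferInstance

section Sign

variable {K : Type} [Field K]

theorem sgn_mul_self (a : ℤ) : sgn K a * sgn K a = 1 := by
  unfold sgn; split_ifs <;> simp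

theorem sgn_add (a b : ℤ) : sgn K (a + b) = sgn K a * sgn K b := by
  unfold sgn
  by_cases ha : Even a <;> by_cases hb : Even b <;> simp [Int.even_add, ha, hb]

theorem sgn_dg_c {n : ℕ} (m : Fin n → ℤ) (p : ℕ) (i j : Fin n) :
    sgn K (dg n m (c p i j)) = -(sgn K (m j) * sgn K (m i)) := by
  have h : dg n m (c p i j) = (1 + (m j + m i)) + (-(p + m i) + -(p + m i)) := by
    simp only [dg]; ring
  rw [h, sgn_add, sgn_add (-(p + m i)), sgn_mul_self, sgn_add, sgn_add,
    show sgn K 1 = -1 by simp [sgn]]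
  ring

end Sign

section Generators

variable {K : Type} [Field K] {n : ℕ}

theorem e_mul_e_self (i : Fin n) : ι K n (e i) * ι K n (e i) = ι K n (e i) := by
  simpa [ι] using RingQuot.mkAlgHom_rel K (Rel.idem (K := K) i)

theorem e_mul_e_of_ne {i j : Fin n} (h : i ≠ j) : ι K n (e i) * ι K n (e j) = 0 := by
  simpa [ι] using RingQuot.mkAlgHom_rel K (Rel.orth (K := K) i j h)

theorem e_mul_e (i j : Fin n) :
    ι K n (e i) * ι K n (e j) = if i = j then ι K n (e i) else 0 := by
  split_ifs with h
  · rw [← h, e_mul_e_self]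
  · exact e_mul_e_of_ne h

theorem sum_e : ∑ i, ι K n (e i) = 1 := by
  simpa [ι] using RingQuot.mkAlgHom_rel K (Rel.total (K := K) (n := n))

theorem e_mul_c_self (p : ℕ) (i j : Fin n) :
    ι K n (e j) * ι K n (c p i j) = ι K n (c p i j) := by
  simpa [ι] using RingQuot.mkAlgHom_rel K (Rel.left (K := K) p i j)

theorem c_mul_e_self (p : ℕ) (i j : Fin n) :
    ι K n (c p i j) * ι K n (e i) = ι K n (c p i j) := by
  simpa [ι] using RingQuot.mkAlgHom_rel K (Rel.right (K := K) p i j)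

theorem c_zero_of_not_lt {i j : Fin n} (h : ¬ i < j) : ι K n (c 0 i j) = 0 := by
  simpa [ι] using RingQuot.mkAlgHom_rel K (Rel.czero (K := K) i j h)

theorem e_mul_c (p : ℕ) (k i j : Fin n) :
    ι K n (e k) * ι K n (c p i j) = if k = j then ι K n (c p i j) else 0 := by
  rw [← e_mul_c_self p i j, ← mul_assoc, e_mul_e]
  split_ifs with h
  · rw [h]
  · rw [zero_mul]

theorem c_mul_e (p : ℕ) (i j k : Fin n) :
    ι K n (c p i j) * ι K n (e k) = if i = k then ι K n (c p i j) else 0 := by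
  rw [← c_mul_e_self p i j, mul_assoc, e_mul_e]
  split_ifs with h
  · rfl
  · rw [mul_zero]

theorem sum_e_mul_mul_e (x : IAlg K n) : ∑ j, ∑ i, ι K n (e j) * x * ι K n (e i) = x := by
  simp_rw [← mul_sum, ← sum_mul, sum_e, one_mul, mul_one]

theorem ext_e {x y : IAlg K n}
    (h : ∀ i j, ι K n (e j) * x * ι K n (e i) = ι K n (e j) * y * ι K n (e i)) : x = y := by
  rw [← sum_e_mul_mul_e x, ← sum_e_mul_mul_e y]
  simp_rw [h]

theorem IAlg.induction {P : IAlg K n → Prop} (one : P 1)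
    (mul : ∀ g x, P x → P (ι K n g * x)) (add : ∀ x y, P x → P y → P (x + y))
    (smul : ∀ (a : K) x, P x → P (a • x)) (x : IAlg K n) : P x := by
  obtain ⟨a, rfl⟩ := RingQuot.mkAlgHom_surjective K (Rel K n) x
  suffices h : ∀ y, P y → P (RingQuot.mkAlgHom K (Rel K n) a * y) by simpa using h 1 one
  induction a using FreeAlgebra.induction with
  | grade0 a =>
    intro y hy
    rw [AlgHom.commutes, ← Algebra.smul_def]
    exact smul a y hy
  | grade1 g => exact fun y hy => mul g y hy
  | mul a b ha hb =>
    intro y hy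
    rw [map_mul, mul_assoc]
    exact ha _ (hb y hy)
  | add a b ha hb =>
    intro y hy
    rw [map_add, add_mul]
    exact add _ _ (ha y hy) (hb y hy)

theorem exists_algHom {S : Type} [Ring S] [Algebra K S] (f : IGen n → S)
    (idem : ∀ i, f (e i) * f (e i) = f (e i))
    (orth : ∀ i j, i ≠ j → f (e i) * f (e j) = 0)
    (total : ∑ i, f (e i) = 1)
    (left : ∀ p i j, f (e j) * f (c p i j) = f (c p i j))
    (right : ∀ p i j, f (c p i j) * f (e i) = f (c p i j))
    (czero : ∀ i j, ¬ i < j → f (c 0 i j) = 0) :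
    ∃ Φ : IAlg K n →ₐ[K] S, ∀ g, Φ (ι K n g) = f g := by
  refine ⟨RingQuot.liftAlgHom K ⟨FreeAlgebra.lift K f, ?_⟩, fun g => ?_⟩
  · intro x y h
    cases h with
    | idem i => simpa using idem i
    | orth i j h => simpa using orth i j h
    | total => simpa using total
    | left p i j => simpa using left p i j
    | right p i j => simpa using right p i j
    | czero i j h => simpa using czero i j h
  · simp [ι]

theorem exists_twisted_derivation (α β : IAlg K n →ₐ[K] IAlg K n)
    (hα : ∀ i, α (ι K n (e i)) = ι K n (e i)) (hβ : ∀ i, β (ι K n (e i)) = ι K n (e i))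
    (h : ℕ → Fin n → Fin n → IAlg K n)
    (left : ∀ p i j, ι K n (e j) * h p i j = h p i j)
    (right : ∀ p i j, h p i j * ι K n (e i) = h p i j)
    (zero : ∀ i j, h 0 i j = 0) :
    ∃ H : IAlg K n →ₗ[K] IAlg K n, (∀ i, H (ι K n (e i)) = 0) ∧
      (∀ p i j, H (ι K n (c p i j)) = h p i j) ∧
      ∀ x y, H (x * y) = H x * β y + α x * H y := by
  let f : IGen n → Matrix (Fin 2) (Fin 2) (IAlg K n)
    | e i => !![ι K n (e i), 0; 0, ι K n (e i)]
    | c p i j => !![α (ι K n (c p i j)), h p i j; 0, β (ι K n (c p i j))]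
  obtain ⟨Φ, hΦ⟩ := exists_algHom (K := K) f
    (fun i => by simp [f, e_mul_e_self])
    (fun i j hij => by
      ext a b; fin_cases a <;> fin_cases b <;> simp [f, e_mul_e_of_ne hij])
    (by
      ext a b
      fin_cases a <;> fin_cases b <;> simp [f, Matrix.sum_apply, sum_e])
    (fun p i j => by
      have h1 := congrArg α (e_mul_c_self (K := K) p i j)
      have h2 := congrArg β (e_mul_c_self (K := K) p i j)
      rw [map_mul, hα] at h1
      rw [map_mul, hβ] at h2
      simp [f, left, h1, h2])
    (fun p i j => by
      have h1 := congrArg α (c_mul_e_self (K := K) p i j)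
      have h2 := congrArg β (c_mul_e_self (K := K) p i j)
      rw [map_mul, hα] at h1
      rw [map_mul, hβ] at h2
      simp [f, right, h1, h2])
    (fun i j hij => by
      ext a b; fin_cases a <;> fin_cases b <;> simp [f, c_zero_of_not_lt hij, zero])
  have key : ∀ x, Φ x 0 0 = α x ∧ Φ x 1 0 = 0 ∧ Φ x 1 1 = β x := by
    intro x
    induction x using IAlg.induction with
    | one => simp
    | mul g x ih =>
      obtain ⟨h1, h2, h3⟩ := ih
      rw [map_mul, hΦ]
      cases g <;> simp [f, Matrix.mul_apply, Fin.sum_univ_two, h1, h2, h3, hα, hβ]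
    | add x y hx hy => simp [hx, hy]
    | smul a x hx => simp [hx]
  refine ⟨{ toFun := fun x => Φ x 0 1, map_add' := ?_, map_smul' := ?_ }, ?_, ?_, ?_⟩
  · intro x y; simp
  · intro a x; simp
  · intro i; simp [hΦ, f]
  · intro p i j; simp [hΦ, f]
  · intro x y
    simp only [LinearMap.coe_mk, AddHom.coe_mk, map_mul, Matrix.mul_apply, Fin.sum_univ_two,
      (key x).1, (key y).2.2]
    rw [add_comm]

end Generators

section Total

variable (K : Type) [Field K] (n : ℕ) (m : Fin n → ℤ)

/-- The signed sum of all generators `c^p_{ij}` with fixed `p`. -/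
def cTot (p : ℕ) : IAlg K n := ∑ j, ∑ i, sgn K (m j) • ι K n (c p i j)

/-- The diagonal sign element of `k_n`. -/
def signElt : IAlg K n := ∑ i, sgn K (m i) • ι K n (e i)

variable {K n}

theorem e_mul_cTot_mul_e (p : ℕ) (i j : Fin n) :
    ι K n (e j) * cTot K n m p * ι K n (e i) = sgn K (m j) • ι K n (c p i j) := by
  simp [cTot, mul_sum, sum_mul, e_mul_c, c_mul_e]

theorem c_eq (p : ℕ) (i j : Fin n) :
    ι K n (c p i j) = sgn K (m j) • (ι K n (e j) * cTot K n m p * ι K n (e i)) := by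
  rw [e_mul_cTot_mul_e, smul_smul, sgn_mul_self, one_smul]

theorem e_mul_signElt (i : Fin n) :
    ι K n (e i) * signElt K n m = sgn K (m i) • ι K n (e i) := by
  simp [signElt, mul_sum, e_mul_e]

theorem signElt_mul_e (i : Fin n) :
    signElt K n m * ι K n (e i) = sgn K (m i) • ι K n (e i) := by
  simp [signElt, sum_mul, e_mul_e]

theorem signElt_mul_self : signElt K n m * signElt K n m = 1 := by
  have h : ∀ i, sgn K (m i) • ι K n (e i) * signElt K n m = ι K n (e i) := fun i => by
    rw [smul_mul_assoc, e_mul_signElt, smul_smul, sgn_mul_self, one_smul]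
  conv_lhs => rw [signElt, sum_mul]
  exact (sum_congr rfl fun i _ => h i).trans sum_e

theorem signElt_mul_signElt_mul (x : IAlg K n) :
    signElt K n m * (signElt K n m * x) = x := by
  rw [← mul_assoc, signElt_mul_self, one_mul]

theorem e_mul_cTot_mul_cTot_mul_e (a b : ℕ) (i j : Fin n) :
    ι K n (e j) * (cTot K n m a * cTot K n m b) * ι K n (e i) =
      sgn K (m j) • ∑ r, sgn K (m r) • (ι K n (c a r j) * ι K n (c b i r)) := by
  have h : ι K n (e j) * (cTot K n m a * cTot K n m b) * ι K n (e i) =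
      ∑ r, (ι K n (e j) * cTot K n m a * ι K n (e r)) *
        (ι K n (e r) * cTot K n m b * ι K n (e i)) := by
    have h1 : ∀ r, (ι K n (e j) * cTot K n m a * ι K n (e r)) *
        (ι K n (e r) * cTot K n m b * ι K n (e i)) =
        ι K n (e j) * cTot K n m a * ι K n (e r) * (cTot K n m b * ι K n (e i)) := by
      intro r
      simp only [mul_assoc]
      rw [← mul_assoc (ι K n (e r)) (ι K n (e r)), e_mul_e_self]
    simp_rw [h1, ← sum_mul, ← mul_sum, sum_e, mul_one, mul_assoc]
  rw [h, smul_sum]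
  refine sum_congr rfl fun r _ => ?_
  rw [e_mul_cTot_mul_e, e_mul_cTot_mul_e, smul_mul_assoc, mul_smul_comm]

theorem Dval_c (p : ℕ) (i j : Fin n) :
    Dval K n m (c p i j) =
      ∑ x ∈ antidiagonal p, ∑ r, sgn K (m r + m j) • (ι K n (c x.1 r j) * ι K n (c x.2 i r))
        + if p = 1 then (if i = j then ι K n (e i) else 0) else 0 := by
  match p with
  | 0 =>
    simp only [Dval, Finset.Nat.antidiagonal_zero, sum_singleton, zero_ne_one, if_false, add_zero]
    refine sum_congr rfl fun r _ => ?_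
    by_cases h1 : i < r <;> by_cases h2 : r < j <;>
      simp [h1, h2, c_zero_of_not_lt]
  | 1 =>
    simp only [Dval, if_true]
    rw [add_comm, Finset.Nat.antidiagonal_succ, sum_cons, sum_map]
    simp only [Finset.Nat.antidiagonal_zero, sum_singleton, sum_add_distrib]
    rw [add_comm (∑ r : Fin n, if i < r then _ else (0 : IAlg K n))]
    congr 2
    · refine sum_congr rfl fun r _ => ?_
      by_cases h : r < j <;> simp [h, c_zero_of_not_lt]
    · refine sum_congr rfl fun r _ => ?_
      by_cases h : i < r <;> simp [h, c_zero_of_not_lt]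
  | p + 2 =>
    rw [← Finset.Nat.sum_antidiagonal_swap, Finset.Nat.sum_antidiagonal_eq_sum_range_succ_mk]
    simp [Dval]

theorem map_chainQ {ε : IAlg K n →ₐ[K] IAlg K n}
    (hε : ∀ p i j, ε (ι K n (c p i j)) = -(sgn K (m j) * sgn K (m i)) • ι K n (c p i j))
    (ks : List (Fin n)) (i j : Fin n) :
    ε (chainQ K n 1 i ks j) =
      ((-1) ^ (ks.length + 1) * (sgn K (m j) * sgn K (m i))) • chainQ K n 1 i ks j := by
  induction ks generalizing i with
  | nil => simp [chainQ, hε]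
  | cons k ks ih =>
    rw [chainQ, map_mul, ih, hε, smul_mul_smul_comm, List.length_cons]
    congr 1
    linear_combination (-(-1) ^ (ks.length + 1) * (sgn K (m j) * sgn K (m i))) *
      sgn_mul_self (K := K) (m k)

theorem map_Rval {ε : IAlg K n →ₐ[K] IAlg K n}
    (hε : ∀ p i j, ε (ι K n (c p i j)) = -(sgn K (m j) * sgn K (m i)) • ι K n (c p i j))
    (p : ℕ) (i j : Fin n) :
    ε (Rval K n m p i j) = -(sgn K (m j) * sgn K (m i)) • Rval K n m p i j := by
  rw [Rval, map_smul, map_sum, smul_comm]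
  congr 1
  rw [Finset.smul_sum]
  refine sum_congr rfl fun ks _ => ?_
  rw [map_smul, map_chainQ m hε, smul_comm, List.length_ofFn, pow_succ, pow_mul]
  simp

theorem exists_parity : ∃ ε : IAlg K n →ₐ[K] IAlg K n,
    (∀ i, ε (ι K n (e i)) = ι K n (e i)) ∧
    ∀ p i j, ε (ι K n (c p i j)) = -(sgn K (m j) * sgn K (m i)) • ι K n (c p i j) := by
  let f : IGen n → IAlg K n
    | e i => ι K n (e i)
    | c p i j => -(sgn K (m j) * sgn K (m i)) • ι K n (c p i j)
  obtain ⟨ε, hε⟩ := exists_algHom (K := K) f e_mul_e_self (fun i j => e_mul_e_of_ne) sum_e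
    (fun p i j => by simp [f, e_mul_c_self]) (fun p i j => by simp [f, c_mul_e_self])
    (fun i j h => by simp [f, c_zero_of_not_lt h])
  exact ⟨ε, fun i => hε _, fun p i j => hε _⟩

end Total

section Homotopy

variable {K : Type} [Field K] {n : ℕ} {m : Fin n → ℤ}

theorem IsDiff.map_one {D : IAlg K n →ₗ[K] IAlg K n} (hD : IsDiff K n m D) : D 1 = 0 := by
  simp [← sum_e, hD.1]

theorem IsDiff.map_mul {D : IAlg K n →ₗ[K] IAlg K n} (hD : IsDiff K n m D)
    {ε : IAlg K n →ₐ[K] IAlg K n} (hεe : ∀ i, ε (ι K n (e i)) = ι K n (e i))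
    (hεc : ∀ p i j, ε (ι K n (c p i j)) = -(sgn K (m j) * sgn K (m i)) • ι K n (c p i j))
    (x y : IAlg K n) : D (x * y) = D x * y + ε x * D y := by
  have hgen (g : IGen n) (y : IAlg K n) :
      D (ι K n g * y) = D (ι K n g) * y + ε (ι K n g) * D y := by
    rw [hD.2.2 (dg n m g) _ _ (Submodule.subset_span ⟨[g], by simp, by simp⟩)]
    cases g with
    | e i => simp [dg, sgn, hεe]
    | c p i j => rw [sgn_dg_c, hεc, smul_mul_assoc]
  induction x using IAlg.induction generalizing y with
  | one => simp [hD.map_one]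
  | mul g x ih =>
    rw [mul_assoc, hgen, ih, hgen, _root_.map_mul]
    noncomm_ring
  | add x x' hx hx' =>
    rw [add_mul, map_add, map_add, map_add, hx, hx']
    noncomm_ring
  | smul a x hx => simp [hx]

/-- `θ x = s ε(x) s` for the parity automorphism `ε` and the sign element `s`. -/
def twist (m : Fin n → ℤ) (ε : IAlg K n →ₐ[K] IAlg K n) : IAlg K n →+* IAlg K n where
  toFun x := signElt K n m * ε x * signElt K n m
  map_one' := by simp [signElt_mul_self]
  map_mul' x y := by
    simp only [_root_.map_mul, mul_assoc, signElt_mul_signElt_mul]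
  map_zero' := by simp
  map_add' x y := by simp [mul_add, add_mul]

/-- `x ↦ s D(x)` for the sign element `s`. -/
def signDiff (m : Fin n → ℤ) (D : IAlg K n →ₗ[K] IAlg K n) : IAlg K n →+ IAlg K n where
  toFun x := signElt K n m * D x
  map_zero' := by simp
  map_add' x y := by simp [mul_add]

theorem map_signElt {f : IAlg K n →ₐ[K] IAlg K n} (hf : ∀ i, f (ι K n (e i)) = ι K n (e i)) :
    f (signElt K n m) = signElt K n m := by
  simp [signElt, hf]

theorem twist_eq_neg {ε : IAlg K n →ₐ[K] IAlg K n} (hεe : ∀ i, ε (ι K n (e i)) = ι K n (e i))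
    {x : IAlg K n} (h : ∀ i j, ε (ι K n (e j) * x * ι K n (e i)) =
      -(sgn K (m j) * sgn K (m i)) • (ι K n (e j) * x * ι K n (e i))) :
    twist m ε x = -x := by
  refine ext_e fun i j => ?_
  have h' := h i j
  rw [map_mul, map_mul, hεe, hεe] at h'
  calc ι K n (e j) * (signElt K n m * ε x * signElt K n m) * ι K n (e i)
      = (ι K n (e j) * signElt K n m) * ε x * (signElt K n m * ι K n (e i)) := by noncomm_ring
    _ = (sgn K (m j) * sgn K (m i)) • (ι K n (e j) * ε x * ι K n (e i)) := by
        rw [e_mul_signElt, signElt_mul_e]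
        simp only [smul_mul_assoc, mul_smul_comm, smul_smul]
        rw [mul_comm]
    _ = ι K n (e j) * -x * ι K n (e i) := by
        rw [h', smul_smul, mul_neg, mul_mul_mul_comm, sgn_mul_self, sgn_mul_self]
        simp

theorem map_e_mul_mul_e {ε : IAlg K n →ₐ[K] IAlg K n}
    (hεe : ∀ i, ε (ι K n (e i)) = ι K n (e i)) {x : IAlg K n}
    (h : ε x = signElt K n m * x * signElt K n m) (i j : Fin n) :
    ε (ι K n (e j) * x * ι K n (e i)) =
      (sgn K (m j) * sgn K (m i)) • (ι K n (e j) * x * ι K n (e i)) := by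
  rw [map_mul, map_mul, hεe, hεe, h]
  calc ι K n (e j) * (signElt K n m * x * signElt K n m) * ι K n (e i)
      = (ι K n (e j) * signElt K n m) * x * (signElt K n m * ι K n (e i)) := by noncomm_ring
    _ = _ := by
        rw [e_mul_signElt, signElt_mul_e]
        simp only [smul_mul_assoc, mul_smul_comm, smul_smul]
        rw [mul_comm]

theorem eq_of_twist_eq {ε : IAlg K n →ₐ[K] IAlg K n} {x y : IAlg K n} (h : twist m ε x = y) :
    ε x = signElt K n m * y * signElt K n m := by
  rw [← h]
  change ε x = signElt K n m * (signElt K n m * ε x * signElt K n m) * signElt K n m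
  rw [mul_assoc (signElt K n m), mul_assoc, mul_assoc, signElt_mul_signElt_mul, signElt_mul_self,
    mul_one]

theorem twist_cTot {ε : IAlg K n →ₐ[K] IAlg K n} (hεe : ∀ i, ε (ι K n (e i)) = ι K n (e i))
    (hεc : ∀ p i j, ε (ι K n (c p i j)) = -(sgn K (m j) * sgn K (m i)) • ι K n (c p i j))
    (p : ℕ) : twist m ε (cTot K n m p) = -cTot K n m p :=
  twist_eq_neg hεe fun i j => by
    rw [e_mul_cTot_mul_e, map_smul, hεc, smul_comm]

theorem IsRetr.twist_cTot {r : IAlg K n →ₐ[K] IAlg K n} (hr : IsRetr K n m r)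
    {ε : IAlg K n →ₐ[K] IAlg K n} (hεe : ∀ i, ε (ι K n (e i)) = ι K n (e i))
    (hεc : ∀ p i j, ε (ι K n (c p i j)) = -(sgn K (m j) * sgn K (m i)) • ι K n (c p i j))
    (p : ℕ) : twist m ε (r (cTot K n m p)) = -r (cTot K n m p) :=
  twist_eq_neg hεe fun i j => by
    have h : ι K n (e j) * r (cTot K n m p) * ι K n (e i) =
        sgn K (m j) • r (ι K n (c p i j)) := by
      rw [← map_smul, ← e_mul_cTot_mul_e, map_mul, map_mul, hr.1, hr.1]
    rw [h, map_smul, smul_comm]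
    congr 1
    match p with
    | 0 => rw [hr.2.1, hεc]
    | 1 => rw [hr.2.2.1, hεc]
    | p + 2 => rw [hr.2.2.2 _ _ _ (by omega), map_Rval m hεc]

theorem signDiff_mul {D : IAlg K n →ₗ[K] IAlg K n} (hD : IsDiff K n m D)
    {ε : IAlg K n →ₐ[K] IAlg K n} (hεe : ∀ i, ε (ι K n (e i)) = ι K n (e i))
    (hεc : ∀ p i j, ε (ι K n (c p i j)) = -(sgn K (m j) * sgn K (m i)) • ι K n (c p i j))
    (x y : IAlg K n) :
    signDiff m D (x * y) = signDiff m D x * y + twist m ε x * signDiff m D y := by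
  change signElt K n m * D (x * y) = signElt K n m * D x * y +
    signElt K n m * ε x * signElt K n m * (signElt K n m * D y)
  rw [hD.map_mul hεe hεc, mul_assoc _ (signElt K n m), signElt_mul_signElt_mul]
  noncomm_ring

theorem map_e_mul_mul_e_of_twisted {H : IAlg K n →ₗ[K] IAlg K n} {α β : IAlg K n →ₐ[K] IAlg K n}
    (hα : ∀ i, α (ι K n (e i)) = ι K n (e i)) (hβ : ∀ i, β (ι K n (e i)) = ι K n (e i))
    (hHe : ∀ i, H (ι K n (e i)) = 0) (hH : ∀ x y, H (x * y) = H x * β y + α x * H y)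
    (x : IAlg K n) (i j : Fin n) :
    H (ι K n (e j) * x * ι K n (e i)) = ι K n (e j) * H x * ι K n (e i) := by
  simp [hH, hHe, hα, hβ]

theorem signDiff_cTot {D : IAlg K n →ₗ[K] IAlg K n} (hD : IsDiff K n m D) (p : ℕ) :
    signDiff m D (cTot K n m p) =
      ∑ x ∈ antidiagonal p, cTot K n m x.1 * cTot K n m x.2 + if p = 1 then 1 else 0 := by
  obtain ⟨ε, hεe, hεc⟩ := exists_parity (K := K) m
  refine ext_e fun i j => ?_
  change ι K n (e j) * (signElt K n m * D (cTot K n m p)) * ι K n (e i) = _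
  rw [← mul_assoc, e_mul_signElt, smul_mul_assoc, smul_mul_assoc,
    ← map_e_mul_mul_e_of_twisted (β := AlgHom.id K _) hεe (fun _ => rfl) hD.1
      (hD.map_mul hεe hεc), e_mul_cTot_mul_e, map_smul, smul_smul, sgn_mul_self, one_smul,
    hD.2.1, Dval_c, mul_add, add_mul, mul_sum, sum_mul]
  congr 1
  · refine sum_congr rfl fun x _ => ?_
    rw [e_mul_cTot_mul_cTot_mul_e, smul_sum]
    refine sum_congr rfl fun r _ => ?_
    rw [smul_smul, sgn_add, mul_comm (sgn K (m r))]
  · by_cases hp : p = 1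
    · simp only [hp, if_true, mul_one, e_mul_e]
      by_cases h : i = j
      · simp [h]
      · simp [h, Ne.symm h]
    · simp [hp]

theorem exists_homotopy {D : IAlg K n →ₗ[K] IAlg K n} (hD : IsDiff K n m D)
    {r : IAlg K n →ₐ[K] IAlg K n} (hr : IsRetr K n m r) (hchain : ∀ x, D (r x) = r (D x)) :
    ∃ H : IAlg K n →ₗ[K] IAlg K n, ∀ x, D (H x) + H (D x) = x - r x := by
  obtain ⟨ε, hεe, hεc⟩ := exists_parity (K := K) m
  set s := signElt K n m with hs
  have hss : s * s = 1 := signElt_mul_self m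
  set b := cTot K n m with hb
  let F : ℕ → IAlg K n := fun p => r (b p)
  let g := gaugeCoeff b F
  have hθb := twist_cTot hεe hεc
  have hθF := hr.twist_cTot hεe hεc
  have hδb := signDiff_cTot hD
  have hrs : r s = s := map_signElt hr.1
  have hrb {p : ℕ} (hp : ∀ i j, r (ι K n (c p i j)) = ι K n (c p i j)) : F p = b p := by
    simp [F, hb, cTot, hp]
  have hDr : ∀ x, signDiff m D (r x) = r (signDiff m D x) := fun x => by
    change s * D (r x) = r (s * D x)
    rw [hchain, map_mul, hrs]
  have hF0 : F 0 = b 0 := hrb hr.2.1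
  have hg := map_gaugeCoeff_eq (twist m ε) (signDiff m D) (signDiff_mul hD hεe hεc)
    hθb hθF hF0 hδb (fun p => by
      rw [hDr, hδb, map_add, map_sum]
      simp only [map_mul, apply_ite r, map_one, map_zero])
  let h : ℕ → IAlg K n := fun p => if p = 0 then 0 else g p
  have hgh (p : ℕ) : g p = h p + if p = 0 then 1 else 0 := by
    by_cases hp : p = 0
    · simp [h, g, hp, gaugeCoeff]
    · simp [h, hp]
  have hθh (p : ℕ) : twist m ε (h p) = h p := by
    by_cases hp : p = 0
    · simp [h, hp]
    · simp only [h, hp, if_false]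
      exact map_gaugeCoeff _ hθb hθF p
  obtain ⟨H, hHe, hHc, hHmul⟩ := exists_twisted_derivation ε r hεe hr.1
    (fun p i j => ι K n (e j) * h p * ι K n (e i))
    (fun p i j => by rw [← mul_assoc, ← mul_assoc, e_mul_e_self])
    (fun p i j => by rw [mul_assoc, e_mul_e_self])
    (fun i j => by simp [h])
  have hHeE := map_e_mul_mul_e_of_twisted hεe hr.1 hHe hHmul
  have hDmul := hD.map_mul hεe hεc
  have hDE := map_e_mul_mul_e_of_twisted (β := AlgHom.id K _) hεe (fun _ => rfl) hD.1 hDmul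
  have hHb (p : ℕ) : H (b p) = s * h p := by
    refine ext_e fun i j => ?_
    rw [← hHeE, e_mul_cTot_mul_e, map_smul, hHc, ← mul_assoc, e_mul_signElt, smul_mul_assoc,
      smul_mul_assoc]
  have hεs : ε s = s := map_signElt hεe
  have hHs : H s = 0 := by simp [hs, signElt, hHe]
  have hDs : D s = 0 := by simp [hs, signElt, hD.1]
  have hH1 : H 1 = 0 := by simp [← sum_e, hHe]
  have hεb (p : ℕ) : ε (b p) = -(s * b p * s) := by
    rw [eq_of_twist_eq (hθb p), mul_neg, neg_mul]
  have hHbb (p q : ℕ) : s * H (b p * b q) = h p * F q - b p * h q := by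
    rw [hHmul, hHb, hHb, hεb, mul_add, neg_mul, mul_neg]
    have h1 : s * (s * h p * r (b q)) = (s * s) * h p * F q := by
      simp only [F, mul_assoc]
    have h2 : s * (s * b p * s * (s * h q)) = (s * s) * b p * (s * s) * h q := by
      simp only [mul_assoc]
    rw [h1, h2, hss]
    noncomm_ring
  have hDb (p : ℕ) : D (b p) = s * signDiff m D (b p) := by
    change _ = s * (s * D (b p))
    rw [← mul_assoc, hss, one_mul]
  have hTb (p : ℕ) : D (H (b p)) + H (D (b p)) = b p - F p := by
    have h1 : D (H (b p)) = signDiff m D (g p) := by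
      have : signDiff m D (g p) = signDiff m D (h p) := by
        rw [hgh, map_add]
        split_ifs
        · change _ + s * D 1 = _
          simp [hD.map_one]
        · simp
      rw [this, hHb, hDmul, hDs, hεs, zero_mul, zero_add]
      rfl
    have h2 : H (D (b p)) = ∑ x ∈ antidiagonal p, (h x.1 * F x.2 - b x.1 * h x.2) := by
      rw [hDb, hHmul, hHs, hεs, zero_mul, zero_add, hδb, map_add, map_sum, apply_ite H, hH1,
        map_zero, ite_self, add_zero, mul_sum]
      exact sum_congr rfl fun x _ => hHbb _ _
    rw [h1, hg, h2, ← sum_add_distrib]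
    have h3 : ∀ x : ℕ × ℕ, b x.1 * g x.2 - g x.1 * F x.2 + (h x.1 * F x.2 - b x.1 * h x.2) =
        b x.1 * (if x.2 = 0 then 1 else 0) - (if x.1 = 0 then 1 else 0) * F x.2 := by
      intro x
      rw [hgh, hgh]
      noncomm_ring
    rw [sum_congr rfl fun x _ => h3 x, sum_sub_distrib]
    congr 1
    · rw [sum_eq_single_of_mem (p, 0) (by simp) fun x hx hne => ?_]
      · simp
      · have : x.2 ≠ 0 := fun h0 => hne (Prod.ext (by simpa [h0] using hx) h0)
        simp [this]
    · rw [sum_eq_single_of_mem (0, p) (by simp) fun x hx hne => ?_]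
      · simp
      · have : x.1 ≠ 0 := fun h0 => hne (Prod.ext h0 (by simpa [h0] using hx))
        simp [this]
  have hgen (x : IGen n) : D (H (ι K n x)) + H (D (ι K n x)) = ι K n x - r (ι K n x) := by
    cases x with
    | e i => simp [hHe, hD.1, hr.1]
    | c p i j =>
      rw [c_eq m]
      simp only [map_smul, map_mul, hr.1, hHeE, hDE]
      rw [← smul_add, ← add_mul, ← mul_add, ← smul_sub, ← sub_mul, ← mul_sub, hTb]
  have hεD (x : IGen n) : D (ε (ι K n x)) = -ε (D (ι K n x)) := by
    cases x with
    | e i => simp [hεe, hD.1]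
    | c p i j =>
      have h1 : ε (D (b p)) = s * D (b p) * s := by
        have h2 : twist m ε (signDiff m D (b p)) = signDiff m D (b p) := by
          rw [hδb, map_add, map_sum]
          simp [apply_ite (twist m ε), hθb]
        have h3 := eq_of_twist_eq h2
        rw [hDb, map_mul, hεs, h3]
        simp only [hs, ← mul_assoc]
      rw [hεc, map_smul, c_eq m, map_smul, hDE, map_smul, map_e_mul_mul_e hεe h1,
        ← smul_neg, smul_comm, ← neg_smul]
  have hεH (x : IGen n) : H (ε (ι K n x)) = -ε (H (ι K n x)) := by
    cases x with
    | e i => simp [hεe, hHe]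
    | c p i j =>
      rw [hεc, map_smul, hHc, map_e_mul_mul_e hεe (eq_of_twist_eq (hθh p)), neg_smul]
  have hεε (x : IGen n) : ε (ε (ι K n x)) = ι K n x := by
    cases x with
    | e i => simp [hεe]
    | c p i j =>
      rw [hεc, map_smul, hεc, smul_smul, neg_mul_neg, mul_mul_mul_comm, sgn_mul_self,
        sgn_mul_self, one_mul, one_smul]
  refine ⟨H, fun x => ?_⟩
  induction x using IAlg.induction with
  | one => simp [hH1, hD.map_one]
  | mul x y ih =>
    have hy : D (H y) = y - r y - H (D y) := by rw [← ih]; abel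
    have hx : D (H (ι K n x)) = ι K n x - r (ι K n x) - H (D (ι K n x)) := by
      rw [← hgen]; abel
    rw [hHmul, hDmul, map_add, map_add, hDmul, hDmul, hHmul, hHmul, hεε, hεD, hεH, hchain,
      hx, hy, map_mul]
    noncomm_ring
  | add x y hx hy =>
    simp only [map_add]
    rw [add_add_add_comm, hx, hy]
    abel
  | smul a x hx => simp only [map_smul, ← smul_add, hx, smul_sub]

end Homotopy

end InternalAlgebra

/-- The retraction `r : I_n → A_n` is a quasi-isomorphism: the map it
induces on cohomology `H(I_n) → H(A_n)` is an isomorphism; equivalently, the inclusion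
`A_n ↪ I_n` induces an isomorphism on cohomology.  (Stated elementwise for the
cohomologies `ker ∂ / im ∂`.) -/
theorem statement2 (K : Type) [Field K] (n : ℕ) (hn : 1 ≤ n) (m : Fin n → ℤ)
    (D : IAlg K n →ₗ[K] IAlg K n) (hD : IsDiff K n m D)
    (r : IAlg K n →ₐ[K] IAlg K n) (hr : IsRetr K n m r)
    (hrA : ∀ x : IAlg K n, r x ∈ Asub K n)
    (hrid : ∀ x : IAlg K n, x ∈ Asub K n → r x = x)
    (hchain : ∀ x : IAlg K n, D (r x) = r (D x)) :
    -- the map induced by `r` on cohomology is surjective: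
    (∀ a : IAlg K n, a ∈ Asub K n → D a = 0 →
      ∃ x : IAlg K n, D x = 0 ∧ ∃ y ∈ Asub K n, r x - a = D y) ∧
    -- the map induced by `r` on cohomology is injective:
    (∀ x : IAlg K n, D x = 0 → (∃ y ∈ Asub K n, r x = D y) →
      ∃ z : IAlg K n, x = D z) ∧
    -- equivalently, the inclusion `A_n ↪ I_n` induces a surjection on cohomology:
    (∀ x : IAlg K n, D x = 0 → ∃ a ∈ Asub K n, ∃ y : IAlg K n, x - a = D y) ∧
    -- and an injection on cohomology:
    (∀ a : IAlg K n, a ∈ Asub K n → D a = 0 → (∃ y : IAlg K n, a = D y) →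
      ∃ b ∈ Asub K n, a = D b) := by
  obtain ⟨H, hH⟩ := exists_homotopy hD hr hchain
  refine ⟨fun a ha hDa => ⟨a, hDa, 0, zero_mem _, by rw [hrid a ha, sub_self, map_zero]⟩,
    ?_, fun x hx => ⟨r x, hrA x, H x, by rw [← hH, hx, map_zero, add_zero]⟩, ?_⟩
  · rintro x hx ⟨y, -, hy⟩
    refine ⟨H x + y, ?_⟩
    have h := hH x
    rw [hx, map_zero, add_zero, hy] at h
    rw [map_add, h, sub_add_cancel]
  · rintro a ha - ⟨y, hy⟩
    exact ⟨r y, hrA y, by rw [hchain, ← hy, hrid a ha]⟩
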